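/- arXiv:2209.14241 — 8 statements merged into one kernel-verified Lean document; each statement's English description precedes it below -/
import Mathlib

section
/- Let K be a division ring and let A, B, C ∈ K be three pairwise distinct points, and let D, D' ∈ K with D ≠ A and D' ≠ A. If c_r(A,B;C,D) = c_r(A,B;C,D'), then D = D'. (Uniqueness of the fourth point realizing a given cross-ratio value.) -/
/-- Cross ratio of four collinear points in the skew field of a line
of a Desargues affine plane: c_r(A,B;C,D) = ((A-D)⁻¹(B-D))((B-C)⁻¹(A-C)). -/
def crossRatio {K : Type*} [DivisionRing K] (A B C D : K) : K :=
  ((A - D)⁻¹ * (B - D)) * ((B - C)⁻¹ * (A - C))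

theorem inv_sub_mul_sub_eq_one_add {K : Type*} [DivisionRing K] {A D : K} (B : K) (h : D ≠ A) :
    (A - D)⁻¹ * (B - D) = 1 + (A - D)⁻¹ * (B - A) := by
  rw [← inv_mul_cancel₀ (sub_ne_zero.2 h.symm), ← mul_add, add_comm, sub_add_sub_cancel]

theorem crossRatio_fourth_point_unique {K : Type*} [DivisionRing K]
    (A B C D D' : K) (hAB : A ≠ B) (hAC : A ≠ C) (hBC : B ≠ C)
    (hDA : D ≠ A) (hD'A : D' ≠ A)
    (h : crossRatio A B C D = crossRatio A B C D') : D = D' := by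
  have hne : (B - C)⁻¹ * (A - C) ≠ 0 :=
    mul_ne_zero (inv_ne_zero (sub_ne_zero.2 hBC)) (sub_ne_zero.2 hAC)
  have hratio := mul_right_cancel₀ hne h
  rw [inv_sub_mul_sub_eq_one_add B hDA, inv_sub_mul_sub_eq_one_add B hD'A] at hratio
  exact sub_right_injective
    (inv_injective (mul_right_cancel₀ (sub_ne_zero.2 hAB.symm) (add_left_cancel hratio)))
end

section
/- Let K be a division ring and let A, B, C, D ∈ K be pairwise distinct points. Then c_r(A,B;C,D) = ((A-B)⁻¹ - (A-D)⁻¹) * ((A-B)⁻¹ - (A-C)⁻¹)⁻¹. -/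
theorem inv_sub_inv_eq_inv_mul_sub_mul_inv {K : Type*} [DivisionRing K] {x y : K}
    (hx : x ≠ 0) (hy : y ≠ 0) : x⁻¹ - y⁻¹ = y⁻¹ * (y - x) * x⁻¹ := by
  rw [mul_sub, sub_mul, inv_mul_cancel₀ hy, one_mul, mul_inv_cancel_right₀ hx]

theorem crossRatio_eq_inv_diff {K : Type*} [DivisionRing K] (A B C D : K)
    (hAB : A ≠ B) (hAC : A ≠ C) (hAD : A ≠ D)
    (hBC : B ≠ C) (hBD : B ≠ D) (hCD : C ≠ D) :
    crossRatio A B C D =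
      ((A - B)⁻¹ - (A - D)⁻¹) * ((A - B)⁻¹ - (A - C)⁻¹)⁻¹ := by
  have hx : A - B ≠ 0 := sub_ne_zero.mpr hAB
  rw [inv_sub_inv_eq_inv_mul_sub_mul_inv hx (sub_ne_zero.mpr hAD),
    inv_sub_inv_eq_inv_mul_sub_mul_inv hx (sub_ne_zero.mpr hAC),
    sub_sub_sub_cancel_left, sub_sub_sub_cancel_left]
  simp only [crossRatio, mul_inv_rev, inv_inv, mul_assoc]
  rw [inv_mul_cancel_left₀ hx]
end

section
/- Let K be a division ring and let A, B, C, D ∈ K be pairwise distinct points. Then 1 - c_r(A,B;C,D) = c_r(A,C;B,D), where 1 is the multiplicative identity of K. -/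
theorem one_sub_crossRatio {K : Type*} [DivisionRing K] (A B C D : K)
    (hAB : A ≠ B) (hAC : A ≠ C) (hAD : A ≠ D)
    (hBC : B ≠ C) (hBD : B ≠ D) (hCD : C ≠ D) :
    1 - crossRatio A B C D = crossRatio A C B D := by
  have hx : A - D ≠ 0 := sub_ne_zero.mpr hAD
  have hy : B - C ≠ 0 := sub_ne_zero.mpr hBC
  have hAC' : A - C = (A - B) + (B - C) := by abel
  have hCD' : C - D = (B - D) - (B - C) := by abel
  have hBD' : B - D = (A - D) - (A - B) := by abel
  have hCB : (C - B)⁻¹ = -(B - C)⁻¹ := by rw [← neg_sub, inv_neg]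
  calc
    1 - crossRatio A B C D
        = 1 - (A - D)⁻¹ * (B - D) * ((B - C)⁻¹ * (A - B)) - (A - D)⁻¹ * (B - D) := by
      rw [crossRatio, hAC', mul_add (B - C)⁻¹, inv_mul_cancel₀ hy, mul_add, mul_one, sub_sub]
    _ = (A - D)⁻¹ * (A - B) - (A - D)⁻¹ * (B - D) * ((B - C)⁻¹ * (A - B)) := by
      have h : (A - D)⁻¹ * (B - D) = 1 - (A - D)⁻¹ * (A - B) := by
        rw [hBD', mul_sub, inv_mul_cancel₀ hx]
      rw [sub_right_comm]
      nth_rewrite 1 [h]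
      rw [sub_sub_cancel]
    _ = crossRatio A C B D := by
      rw [crossRatio, hCB, hCD', neg_mul, mul_neg, mul_sub (A - D)⁻¹ (B - D), sub_mul, neg_sub,
        mul_assoc (A - D)⁻¹ (B - C), mul_inv_cancel_left₀ hy]
end

section
/- Let K be a division ring and let A, B, C, D ∈ K be pairwise distinct points. Then c_r(A,D;B,C) = 1 - (c_r(A,B;C,D))⁻¹. -/
theorem crossRatio_ADBC {K : Type*} [DivisionRing K] (A B C D : K)
    (hAB : A ≠ B) (hAC : A ≠ C) (hAD : A ≠ D)
    (hBC : B ≠ C) (hBD : B ≠ D) (hCD : C ≠ D) :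
    crossRatio A D B C = 1 - (crossRatio A B C D)⁻¹ := by
  have hAC' : A - C ≠ 0 := sub_ne_zero.mpr hAC
  have hBD' : B - D ≠ 0 := sub_ne_zero.mpr hBD
  have key : (D - C) * ((D - B)⁻¹ * (A - B)) =
      (A - C) - (B - C) * ((B - D)⁻¹ * (A - D)) := by
    have hDC : D - C = (B - C) - (B - D) := by abel
    have hAD' : A - D = (A - B) + (B - D) := by abel
    rw [hDC, hAD', ← neg_sub B D, inv_neg, mul_add, inv_mul_cancel₀ hBD', sub_mul, neg_mul,
      mul_neg, mul_neg, mul_inv_cancel_left₀ hBD', mul_add, mul_one]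
    abel
  simp only [crossRatio, mul_inv_rev, inv_inv, mul_assoc]
  rw [key, mul_sub, inv_mul_cancel₀ hAC']
end

section
/- Let K be a division ring and let A, B, C, D ∈ K be pairwise distinct points. Then c_r(A,D;C,B) = (c_r(A,B;C,D) - 1)⁻¹ * c_r(A,B;C,D). -/
theorem mul_inv_sub_mul_comm {K : Type*} [DivisionRing K] {q s : K} (h : q ≠ s) :
    q * (q - s)⁻¹ * s = s * (q - s)⁻¹ * q := by
  have ht : q - s ≠ 0 := sub_ne_zero.mpr h
  obtain ⟨t, rfl⟩ : ∃ t, q = t + s := ⟨q - s, (sub_add_cancel q s).symm⟩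
  rw [add_sub_cancel_right] at ht ⊢
  simp only [add_mul, mul_add, mul_inv_cancel₀ ht, one_mul, inv_mul_cancel_right₀ ht]

theorem crossRatio_sub_one {K : Type*} [DivisionRing K] {A B C D : K}
    (hAD : A ≠ D) (hBC : B ≠ C) :
    crossRatio A B C D - 1 = (A - D)⁻¹ * (C - D) * (B - C)⁻¹ * (A - B) := by
  have hp : A - D ≠ 0 := sub_ne_zero.mpr hAD
  have hs : B - C ≠ 0 := sub_ne_zero.mpr hBC
  apply mul_left_cancel₀ hp
  have hAC : A - C = (B - C) + (A - B) := by abel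
  have hCD : C - D = (B - D) - (B - C) := by abel
  simp only [crossRatio, mul_sub _ _ (1 : K), mul_one, mul_assoc, mul_inv_cancel_left₀ hp]
  rw [hAC, hCD, sub_mul (B - D), mul_inv_cancel_left₀ hs, mul_add, inv_mul_cancel₀ hs,
    mul_add (B - D), mul_one]
  abel

theorem crossRatio_ADCB {K : Type*} [DivisionRing K] (A B C D : K)
    (hAB : A ≠ B) (hAC : A ≠ C) (hAD : A ≠ D)
    (hBC : B ≠ C) (hBD : B ≠ D) (hCD : C ≠ D) :
    crossRatio A D C B = (crossRatio A B C D - 1)⁻¹ * crossRatio A B C D := by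
  have hs : B - C ≠ 0 := sub_ne_zero.mpr hBC
  have hp : A - D ≠ 0 := sub_ne_zero.mpr hAD
  have key : (B - D) * (C - D)⁻¹ = (B - C) * (C - D)⁻¹ * (B - D) * (B - C)⁻¹ := by
    rw [eq_mul_inv_iff_mul_eq₀ hs]
    have h := mul_inv_sub_mul_comm (q := B - D) (s := B - C) (by simpa using hCD.symm)
    rwa [sub_sub_sub_cancel_left] at h
  calc crossRatio A D C B
      = (A - B)⁻¹ * ((B - D) * (C - D)⁻¹) * (A - C) := by
        rw [crossRatio, ← neg_sub B D, ← neg_sub C D, inv_neg]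
        simp only [mul_neg, neg_mul, neg_neg, mul_assoc]
    _ = (crossRatio A B C D - 1)⁻¹ * crossRatio A B C D := by
        rw [key, crossRatio_sub_one hAD hBC, crossRatio]
        simp only [mul_inv_rev, inv_inv, mul_assoc, mul_inv_cancel_left₀ hp]
end

section
/- Let K be a division ring and let A, B, C, D ∈ K be pairwise distinct points, each different from 0. Then c_r(A⁻¹,B⁻¹;C⁻¹,D⁻¹) = A * c_r(A,B;C,D) * A⁻¹; that is, the cross ratio of the multiplicative inverses of the four points is conjugate (by A) to the cross ratio of the points. -/
theorem inv_sub_inv_inv_mul_inv_sub_inv {K : Type*} [DivisionRing K] {a b d : K}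
    (ha : a ≠ 0) (hb : b ≠ 0) (hd : d ≠ 0) :
    (a⁻¹ - d⁻¹)⁻¹ * (b⁻¹ - d⁻¹) = a * ((a - d)⁻¹ * (b - d)) * b⁻¹ := by
  have key {x : K} (hx : x ≠ 0) : x⁻¹ - d⁻¹ = -(d⁻¹ * (x - d) * x⁻¹) := by
    simp [mul_sub, sub_mul, hx, hd]
  rw [key ha, key hb, inv_neg, neg_mul_neg]
  simp [mul_assoc, hd]

theorem crossRatio_inv_points {K : Type*} [DivisionRing K] (A B C D : K)
    (hAB : A ≠ B) (hAC : A ≠ C) (hAD : A ≠ D)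
    (hBC : B ≠ C) (hBD : B ≠ D) (hCD : C ≠ D)
    (hA : A ≠ 0) (hB : B ≠ 0) (hC : C ≠ 0) (hD : D ≠ 0) :
    crossRatio A⁻¹ B⁻¹ C⁻¹ D⁻¹ = A * crossRatio A B C D * A⁻¹ := by
  unfold crossRatio
  rw [inv_sub_inv_inv_mul_inv_sub_inv hA hB hD, inv_sub_inv_inv_mul_inv_sub_inv hB hA hC]
  simp [mul_assoc, hB]
end

section
/- Let K be a division ring and let A, B, C, D ∈ K be pairwise distinct points, each different from 0. If A lies in the center of K (i.e. A commutes with every element of K), then c_r(A⁻¹,B⁻¹;C⁻¹,D⁻¹) = c_r(A,B;C,D). -/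
theorem inv_inv_sub_inv_mul_inv_sub_inv {K : Type*} [DivisionRing K] {x y z : K}
    (hx : x ≠ 0) (hy : y ≠ 0) (hz : z ≠ 0) :
    (x⁻¹ - z⁻¹)⁻¹ * (y⁻¹ - z⁻¹) = x * ((x - z)⁻¹ * (y - z)) * y⁻¹ := by
  have key {w : K} (hw : w ≠ 0) : w⁻¹ - z⁻¹ = -(z⁻¹ * (w - z) * w⁻¹) := by
    rw [← neg_sub, inv_sub_inv' hz hw]
  rw [key hx, key hy, inv_neg, neg_mul_neg]
  simp only [mul_inv_rev, inv_inv, mul_assoc, mul_inv_cancel_left₀ hz]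

/-- Inverting all four points conjugates the cross ratio by the first one. -/
theorem crossRatio_inv {K : Type*} [DivisionRing K] {A B C D : K}
    (hA : A ≠ 0) (hB : B ≠ 0) (hC : C ≠ 0) (hD : D ≠ 0) :
    crossRatio A⁻¹ B⁻¹ C⁻¹ D⁻¹ = A * crossRatio A B C D * A⁻¹ := by
  unfold crossRatio
  rw [inv_inv_sub_inv_mul_inv_sub_inv hA hB hD, inv_inv_sub_inv_mul_inv_sub_inv hB hA hC]
  simp only [mul_assoc, inv_mul_cancel_left₀ hB]

theorem crossRatio_inv_points_central {K : Type*} [DivisionRing K] (A B C D : K)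
    (hAB : A ≠ B) (hAC : A ≠ C) (hAD : A ≠ D)
    (hBC : B ≠ C) (hBD : B ≠ D) (hCD : C ≠ D)
    (hA : A ≠ 0) (hB : B ≠ 0) (hC : C ≠ 0) (hD : D ≠ 0)
    (hcenter : ∀ x : K, A * x = x * A) :
    crossRatio A⁻¹ B⁻¹ C⁻¹ D⁻¹ = crossRatio A B C D := by
  rw [crossRatio_inv hA hB hC hD, hcenter, mul_inv_cancel_right₀ hA]
end

section
/- Let K be a division ring and let A, B ∈ K with A ≠ B. Then the map D ↦ (A-D)⁻¹ * (B-D) is injective on K \ {A}; that is, if D ≠ A, D' ≠ A and (A-D)⁻¹ * (B-D) = (A-D')⁻¹ * (B-D'), then D = D'. -/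
theorem ratio_injective {K : Type*} [DivisionRing K] (A B D D' : K)
    (hAB : A ≠ B) (hDA : D ≠ A) (hD'A : D' ≠ A)
    (h : (A - D)⁻¹ * (B - D) = (A - D')⁻¹ * (B - D')) : D = D' := by
  have ratio_eq (X : K) (hX : X ≠ A) :
      (A - X)⁻¹ * (B - X) = 1 - (A - X)⁻¹ * (A - B) := by
    rw [← inv_mul_cancel₀ (sub_ne_zero.mpr hX.symm), ← mul_sub, sub_sub_sub_cancel_left]
  rw [ratio_eq D hDA, ratio_eq D' hD'A] at h
  exact sub_right_injective (inv_injective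
    (mul_right_cancel₀ (sub_ne_zero.mpr hAB) (sub_right_injective h)))
end
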